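/- Fix α > 0 and let ε ~ N(0,1). Then lim_{δ → 0⁺} { log E[(1 − π_α(α + 1 + (α+1)δε))²] − 2 log δ } = 2 log(α + 1). -/

import Mathlib

open MeasureTheory ProbabilityTheory Real Filter

/-- The soft-threshold operator `π_α(u) = sign(u)·(|u| - α)₊`. -/
noncomputable def softThreshold (α u : ℝ) : ℝ :=
  Real.sign u * max (|u| - α) 0

lemma softThreshold_eq_max_sub_max {α : ℝ} (hα : 0 ≤ α) (u : ℝ) :
    softThreshold α u = max (u - α) 0 - max (-u - α) 0 := by
  unfold softThreshold
  rcases lt_trichotomy u 0 with h | rfl | h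
  · rw [Real.sign_of_neg h, abs_of_neg h, max_eq_right (by linarith : u - α ≤ 0)]
    ring
  · simp
  · rw [Real.sign_of_pos h, abs_of_pos h, max_eq_right (by linarith : -u - α ≤ 0)]
    ring

lemma continuous_softThreshold {α : ℝ} (hα : 0 ≤ α) : Continuous (softThreshold α) := by
  rw [funext (softThreshold_eq_max_sub_max hα)]
  fun_prop

lemma softThreshold_of_le {α u : ℝ} (hα : 0 ≤ α) (hu : α ≤ u) :
    softThreshold α u = u - α := by
  rw [softThreshold_eq_max_sub_max hα, max_eq_left (by linarith), max_eq_right (by linarith),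
    sub_zero]

lemma abs_one_sub_softThreshold_le {α : ℝ} (hα : 0 ≤ α) (h : ℝ) :
    |1 - softThreshold α (α + 1 + h)| ≤ |h| := by
  rw [softThreshold_eq_max_sub_max hα]
  grind

lemma integral_sq_gaussianReal_zero (v : NNReal) : ∫ x, x ^ 2 ∂(gaussianReal 0 v) = v := by
  have h := variance_fun_id_gaussianReal (μ := 0) (v := v)
  rwa [variance_of_integral_eq_zero aemeasurable_id' integral_id_gaussianReal] at h

lemma integrable_sq_gaussianReal (μ : ℝ) (v : NNReal) :
    Integrable (fun x ↦ x ^ 2) (gaussianReal μ v) :=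
  (memLp_id_gaussianReal 2).integrable_sq

lemma tendsto_integral_one_sub_softThreshold_div_sq {α : ℝ} (hα : 0 ≤ α) :
    Tendsto
      (fun δ : ℝ => (∫ ε, (1 - softThreshold α (α + 1 + (α + 1) * δ * ε)) ^ 2
        ∂(gaussianReal 0 1)) / δ ^ 2)
      (nhdsWithin 0 (Set.Ioi 0)) (nhds ((α + 1) ^ 2)) := by
  have hlim : ∫ ε, (α + 1) ^ 2 * ε ^ 2 ∂(gaussianReal 0 1) = (α + 1) ^ 2 := by
    rw [integral_const_mul, integral_sq_gaussianReal_zero]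
    simp
  rw [← hlim]
  simp_rw [← integral_div]
  refine tendsto_integral_filter_of_dominated_convergence (fun ε ↦ (α + 1) ^ 2 * ε ^ 2)
    (.of_forall fun δ ↦ ?_) ?_ ((integrable_sq_gaussianReal 0 1).const_mul _)
    (.of_forall fun ε ↦ ?_)
  · have := continuous_softThreshold hα
    exact Continuous.aestronglyMeasurable (by fun_prop)
  · filter_upwards [self_mem_nhdsWithin] with δ (hδ : 0 < δ)
    refine .of_forall fun ε ↦ ?_
    rw [Real.norm_of_nonneg (by positivity), div_le_iff₀ (by positivity)]
    calc _ ≤ ((α + 1) * δ * ε) ^ 2 := sq_le_sq.mpr (abs_one_sub_softThreshold_le hα _)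
      _ = _ := by ring
  · have hcont : Tendsto (fun δ : ℝ ↦ 1 + (α + 1) * δ * ε) (nhdsWithin 0 (Set.Ioi 0)) (nhds 1) := by
      have : Continuous fun δ : ℝ ↦ 1 + (α + 1) * δ * ε := by fun_prop
      simpa using (this.tendsto 0).mono_left nhdsWithin_le_nhds
    refine tendsto_const_nhds.congr' ?_
    filter_upwards [self_mem_nhdsWithin, hcont.eventually_const_lt zero_lt_one]
      with δ (hδ : 0 < δ) h
    rw [softThreshold_of_le hα (by linarith)]
    field_simp
    ring

/-- Fix `α > 0` and let `ε ~ N(0,1)`. Then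
`lim_{δ → 0⁺} { log E[(1 - π_α(α + 1 + (α+1)δε))²] - 2 log δ } = 2 log(α+1)`. -/
theorem softThreshold_log_expectation_limit (α : ℝ) (hα : 0 < α) :
    Tendsto
      (fun δ : ℝ =>
        Real.log (∫ ε, (1 - softThreshold α (α + 1 + (α + 1) * δ * ε)) ^ 2
            ∂(gaussianReal 0 1)) - 2 * Real.log δ)
      (nhdsWithin 0 (Set.Ioi 0)) (nhds (2 * Real.log (α + 1))) := by
  have h := tendsto_integral_one_sub_softThreshold_div_sq hα.le
  have hpos : (0 : ℝ) < (α + 1) ^ 2 := by positivity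
  have hlog := h.log hpos.ne'
  rw [Real.log_pow, Nat.cast_ofNat] at hlog
  refine hlog.congr' ?_
  filter_upwards [self_mem_nhdsWithin, h.eventually_const_lt hpos] with δ (hδ : 0 < δ) hI
  rw [Real.log_div (fun h0 ↦ by simp [h0] at hI) (by positivity), Real.log_pow, Nat.cast_ofNat]
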